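/- Let Γ be a finite group, Γ' ⊆ Γ a subgroup, and χ the character of an irreducible complex representation of Γ'. Let χ̄ : Γ → ℂ be the extension of χ by zero outside Γ', and let Ind χ : Γ → ℂ be the induced class function, Ind χ(g) = (1/|Γ'|) · Σ_{y ∈ Γ, y⁻¹gy ∈ Γ'} χ(y⁻¹gy). Then Ind χ is the character of an irreducible representation of Γ (equivalently, ⟨Ind χ, Ind χ⟩_Γ = 1) if and only if χ̄ * δ_x * χ̄ = 0 for every x ∈ Γ with x ∉ Γ', where δ_x is the delta function at x. -/

import Mathlib

open CategoryTheory Finset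

/-- Convolution of functions on a finite group: `(f * g)(z) = ∑ u, f u * g (u⁻¹ * z)`. -/
noncomputable def convFun {Γ : Type} [Group Γ] [Fintype Γ] (f g : Γ → ℂ) : Γ → ℂ :=
  fun z => ∑ u : Γ, f u * g (u⁻¹ * z)

/-- The trace of an endomorphism of `ι → M` is the sum of the traces of its diagonal blocks. -/
theorem trace_pi_eq_sum_trace_diag {R ι M : Type*} [CommRing R] [Fintype ι] [DecidableEq ι]
    [AddCommGroup M] [Module R M] [Module.Free R M] [Module.Finite R M]
    (f : (ι → M) →ₗ[R] (ι → M)) :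
    LinearMap.trace R (ι → M) f =
      ∑ i, LinearMap.trace R M
        (LinearMap.proj i ∘ₗ f ∘ₗ LinearMap.single R (fun _ : ι => M) i) := by
  have hf : f = ∑ i, (f ∘ₗ LinearMap.single R (fun _ : ι => M) i) ∘ₗ LinearMap.proj i := by
    ext1 i
    ext v j
    rw [LinearMap.comp_apply, LinearMap.comp_apply, LinearMap.sum_apply, Finset.sum_apply,
      Finset.sum_eq_single i]
    · simp
    · intro c _ hc
      simp [Pi.single_eq_of_ne hc]
    · simp
  conv_lhs => rw [hf, map_sum]
  exact Finset.sum_congr rfl fun i _ => LinearMap.trace_comp_comm' _ _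

namespace Representation

/-- The character of a representation coinduced from a subgroup. -/
theorem character_coind_subtype {k G V : Type*} [Field k] [CharZero k] [Group G] [Fintype G]
    [AddCommGroup V] [Module k V] [FiniteDimensional k V]
    (H : Subgroup G) [DecidablePred (· ∈ H)] (ρ : Representation k H V) (g : G) :
    (coind H.subtype ρ).character g =
      (Fintype.card H : k)⁻¹ * ∑ y : G,
        (if h : y⁻¹ * g * y ∈ H then ρ.character ⟨y⁻¹ * g * y, h⟩ else 0) := by
  classical
  have hcard : (Fintype.card H : k) ≠ 0 := Nat.cast_ne_zero.mpr Fintype.card_ne_zero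
  let E : (G → V) →ₗ[k] (G → V) := (Fintype.card H : k)⁻¹ •
    ∑ h : H, LinearMap.pi fun y => ρ h ∘ₗ LinearMap.proj ((h : G)⁻¹ * y * g)
  have hE (f : G → V) (y : G) :
      E f y = (Fintype.card H : k)⁻¹ • ∑ h : H, ρ h (f ((h : G)⁻¹ * y * g)) := by
    simp [E, Finset.sum_apply]
  have hmem (f : G → V) : E f ∈ coindV H.subtype ρ := by
    intro a y
    rw [hE, hE, map_smul, map_sum]
    congr 1
    refine Fintype.sum_equiv (Equiv.mulLeft a⁻¹) _ _ fun h => ?_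
    rw [← Module.End.mul_apply, ← map_mul]
    simp [mul_assoc]
  have hrestrict : coind H.subtype ρ g = E.restrict (fun f _ => hmem f) := by
    ext f y
    obtain ⟨f, hf⟩ := f
    have hf' (a : H) (y : G) : f (a * y) = ρ a (f y) := hf a y
    have hterm (h : H) : ρ h (f ((h : G)⁻¹ * y * g)) = f (y * g) := by
      rw [← hf']
      congr 1
      group
    change f (y * g) = E f y
    simp [hE, hterm, ← Nat.cast_smul_eq_nsmul k, smul_smul, hcard]
  rw [character, hrestrict, LinearMap.trace_restrict_eq_of_forall_mem _ _ hmem,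
    trace_pi_eq_sum_trace_diag, Finset.mul_sum]
  refine Fintype.sum_equiv (Equiv.inv G) _ _ fun y => ?_
  have hdiag : LinearMap.proj y ∘ₗ E ∘ₗ LinearMap.single k (fun _ : G => V) y =
      (Fintype.card H : k)⁻¹ • ∑ h : H, if (h : G) = y * g * y⁻¹ then ρ h else 0 := by
    ext v
    simp only [LinearMap.comp_apply, LinearMap.proj_apply, hE, LinearMap.smul_apply,
      LinearMap.sum_apply, LinearMap.single_apply]
    congr 1
    refine Finset.sum_congr rfl fun h _ => ?_
    have hiff : (h : G)⁻¹ * y * g = y ↔ (h : G) = y * g * y⁻¹ := by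
      rw [mul_assoc, inv_mul_eq_iff_eq_mul, eq_mul_inv_iff_mul_eq, eq_comm]
    by_cases hy : (h : G) = y * g * y⁻¹
    · rw [hiff.mpr hy, if_pos hy, Pi.single_eq_same]
    · rw [if_neg hy, Pi.single_eq_of_ne (mt hiff.mp hy), map_zero, LinearMap.zero_apply]
  rw [hdiag, map_smul, map_sum, smul_eq_mul]
  congr 1
  simp only [Equiv.inv_apply, inv_inv]
  split_ifs with h
  · rw [Finset.sum_eq_single ⟨y * g * y⁻¹, h⟩]
    · simp [character]
    · intro b _ hb
      rw [if_neg (fun hb' => hb (Subtype.ext hb')), map_zero]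
    · simp
  · refine Finset.sum_eq_zero fun b _ => ?_
    rw [if_neg (fun hb : (b : G) = y * g * y⁻¹ => h (hb ▸ b.2)), map_zero]

section

variable {k G V : Type*} [Field k] [CharZero k] [Group G] [AddCommGroup V] [Module k V]
  [FiniteDimensional k V] (ρ : Representation k G V) (K : Subgroup G) [Fintype K]

/-- The sum of a character over a subgroup is a natural number. -/
theorem exists_sum_character_eq_natCast : ∃ n : ℕ, ∑ x : K, ρ.character x = n := by
  have hcard : (Nat.card K : k) ≠ 0 := Nat.cast_ne_zero.mpr Nat.card_pos.ne'
  have := invertibleOfNonzero hcard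
  have h := card_inv_mul_sum_char_eq_finrank (ρ.comp K.subtype)
  rw [inv_mul_eq_iff_eq_mul₀ hcard] at h
  exact ⟨_, h.trans (Nat.cast_mul _ _).symm⟩

/-- If a character sums to zero over a subgroup, then it sums to zero over every coset. -/
theorem sum_character_mul_eq_zero (h0 : ∑ x : K, ρ.character x = 0) (g : G) :
    ∑ x : K, ρ.character (x * g) = 0 := by
  have hcard : (Nat.card K : k) ≠ 0 := Nat.cast_ne_zero.mpr Nat.card_pos.ne'
  have := invertibleOfNonzero hcard
  have h := card_inv_mul_sum_char_eq_finrank (ρ.comp K.subtype)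
  have hsum : ∑ x : K, character (ρ.comp K.subtype) x = 0 := h0
  rw [hsum, mul_zero, eq_comm, Nat.cast_eq_zero, Submodule.finrank_eq_zero] at h
  have hzero : ∑ x : K, ρ x = 0 := by
    ext v
    rw [LinearMap.zero_apply, ← Submodule.mem_bot k, ← h, mem_invariants]
    intro y
    simp only [LinearMap.sum_apply, map_sum]
    refine Fintype.sum_equiv (Equiv.mulLeft y) _ _ fun x => ?_
    simp
  simp only [character, map_mul]
  rw [← map_sum, ← Finset.sum_mul, hzero, zero_mul, map_zero]

end

end Representation

/-- The squared norm of an induced function, as a sum over group elements. -/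
theorem sum_induced_mul_induced_inv {Γ : Type*} [Group Γ] [Fintype Γ] (c : ℂ) (φ : Γ → ℂ) :
    ∑ g : Γ, (c * ∑ y : Γ, φ (y⁻¹ * g * y)) * (c * ∑ y : Γ, φ (y⁻¹ * g⁻¹ * y)) =
      c ^ 2 * (Fintype.card Γ * ∑ x : Γ, ∑ u : Γ, φ u * φ (x⁻¹ * u⁻¹ * x)) := by
  have hterm (y : Γ) : ∑ g : Γ, φ (y⁻¹ * g * y) * ∑ z : Γ, φ (z⁻¹ * g⁻¹ * z) =
      ∑ x : Γ, ∑ u : Γ, φ u * φ (x⁻¹ * u⁻¹ * x) := by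
    rw [Finset.sum_comm]
    refine Fintype.sum_equiv (MulAut.conj y⁻¹).toEquiv _ _ fun g => ?_
    rw [← Finset.mul_sum]
    congr 1
    · simp
    · refine Fintype.sum_equiv (Equiv.mulLeft y⁻¹) _ _ fun z => ?_
      simp [mul_assoc]
  calc _ = c ^ 2 * ∑ y : Γ, ∑ g : Γ, φ (y⁻¹ * g * y) * ∑ z : Γ, φ (z⁻¹ * g⁻¹ * z) := by
        rw [Finset.sum_comm, Finset.mul_sum]
        refine Finset.sum_congr rfl fun g _ => ?_
        rw [← Finset.sum_mul]
        ring
    _ = _ := by simp [hterm]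

theorem convFun_convFun_delta {Γ : Type} [Group Γ] [Fintype Γ] [DecidableEq Γ] (φ ψ : Γ → ℂ)
    (x z : Γ) : convFun (convFun φ (fun u => if u = x then (1 : ℂ) else 0)) ψ z =
      ∑ u : Γ, φ u * ψ (x⁻¹ * u⁻¹ * z) := by
  have h (w : Γ) : convFun φ (fun u => if u = x then (1 : ℂ) else 0) w = φ (w * x⁻¹) := by
    have hiff (u : Γ) : u⁻¹ * w = x ↔ u = w * x⁻¹ := by
      rw [inv_mul_eq_iff_eq_mul, eq_mul_inv_iff_mul_eq, eq_comm]
    simp [convFun, hiff]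
  simp only [convFun] at h ⊢
  simp only [h]
  refine Fintype.sum_equiv (Equiv.mulRight x⁻¹) _ _ fun u => ?_
  simp

/-- The subgroup of pairs `(a, b)` in `H × H` with `a = x b x⁻¹`. -/
def conjPairs {Γ : Type*} [Group Γ] (H : Subgroup Γ) (x : Γ) : Subgroup (H × H) where
  carrier := {p | (p.1 : Γ) * x = x * p.2}
  one_mem' := by simp
  mul_mem' {p q} hp hq := by
    simp only [Set.mem_ofPred_eq, Prod.fst_mul, Prod.snd_mul, Subgroup.coe_mul] at hp hq ⊢
    rw [mul_assoc, hq, ← mul_assoc, hp, mul_assoc]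
  inv_mem' {p} hp := by
    simp only [Set.mem_ofPred_eq, Prod.fst_inv, Prod.snd_inv, Subgroup.coe_inv] at hp ⊢
    rw [inv_mul_eq_iff_eq_mul, ← mul_assoc, hp, mul_inv_cancel_right]

/-- The representation of `H × H` on the endomorphisms of a representation of `H`. -/
noncomputable def endBiRep {H V : Type*} [Group H] [AddCommGroup V] [Module ℂ V]
    (ρ : Representation ℂ H V) : Representation ℂ (H × H) (V →ₗ[ℂ] V) :=
  Representation.linHom (ρ.comp (MonoidHom.fst H H)) (ρ.comp (MonoidHom.snd H H))

theorem character_endBiRep {H V : Type*} [Group H] [AddCommGroup V] [Module ℂ V]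
    [FiniteDimensional ℂ V] (ρ : Representation ℂ H V) (p : H × H) :
    (endBiRep ρ).character p = ρ.character p.1⁻¹ * ρ.character p.2 :=
  Representation.char_linHom _ _ p

section ExtendByZero

variable {Γ : Type*} [Group Γ] (H : Subgroup Γ) [DecidablePred (· ∈ H)]

/-- The extension by zero of a function on a subgroup. -/
def extendByZero (χ : H → ℂ) (g : Γ) : ℂ := if h : g ∈ H then χ ⟨g, h⟩ else 0

variable {H}

theorem extendByZero_coe (χ : H → ℂ) (h : H) : extendByZero H χ h = χ h := by
  simp [extendByZero]

theorem extendByZero_of_notMem (χ : H → ℂ) {g : Γ} (h : g ∉ H) : extendByZero H χ g = 0 :=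
  dif_neg h

variable [Fintype Γ] [Fintype H]

theorem sum_extendByZero_mul (χ : H → ℂ) (f : Γ → ℂ) :
    ∑ u : Γ, extendByZero H χ u * f u = ∑ h : H, χ h * f h := by
  symm
  refine Finset.sum_of_injOn Subtype.val Subtype.val_injective.injOn (by simp) ?_ ?_
  · intro u _ hu
    rw [extendByZero_of_notMem, zero_mul]
    simpa using hu
  · intro h _
    rw [extendByZero_coe]

variable {V : Type*} [AddCommGroup V] [Module ℂ V] (ρ : Representation ℂ H V)

theorem sum_extendByZero_of_mem {x : Γ} (hx : x ∈ H) :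
    ∑ u : Γ, extendByZero H ρ.character u * extendByZero H ρ.character (x⁻¹ * u⁻¹ * x) =
      ∑ h : H, ρ.character h * ρ.character h⁻¹ := by
  rw [sum_extendByZero_mul]
  refine Finset.sum_congr rfl fun h _ => ?_
  rw [← ρ.char_conj h⁻¹ ⟨x, hx⟩⁻¹, ← extendByZero_coe ρ.character (_ * _ * _)]
  simp

variable [FiniteDimensional ℂ V]

theorem sum_extendByZero_eq_sum_character (x : Γ) [Fintype (conjPairs H x)] (p : H × H) :
    ∑ u : Γ, extendByZero H ρ.character u *
        extendByZero H ρ.character (x⁻¹ * u⁻¹ * ((p.1 : Γ)⁻¹ * x * p.2)) =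
      ∑ q : conjPairs H x, (endBiRep ρ).character (q * p) := by
  rw [sum_extendByZero_mul]
  symm
  refine Finset.sum_of_injOn (fun q => ((q : H × H) * p).1⁻¹) ?_ (by simp) ?_ ?_
  · rintro ⟨⟨a, b⟩, hq⟩ - ⟨⟨a', b'⟩, hq'⟩ - h
    have hq : (a : Γ) * x = x * b := hq
    have hq' : (a' : Γ) * x = x * b' := hq'
    have h : a = a' := by simpa using h
    subst h
    have : b = b' := Subtype.ext (mul_left_cancel (hq.symm.trans hq'))
    subst this
    rfl
  · intro u _ hu
    rw [extendByZero_of_notMem, mul_zero]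
    intro hmem
    refine hu ⟨⟨(u⁻¹ * p.1⁻¹, ⟨_, hmem⟩ * p.2⁻¹), ?_⟩, by simp, by simp⟩
    change ((u⁻¹ * p.1⁻¹ : H) : Γ) * x = x * ((⟨_, hmem⟩ * p.2⁻¹ : H) : Γ)
    simp [mul_assoc]
  · rintro ⟨⟨a, b⟩, hq⟩ -
    have hq : (a : Γ) * x = x * b := hq
    rw [character_endBiRep]
    congr 1
    rw [← extendByZero_coe (H := H) ρ.character]
    congr 1
    have hb : (b : Γ) = x⁻¹ * (a * x) := by rw [hq, inv_mul_cancel_left]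
    simp [mul_assoc, hb]

theorem exists_sum_extendByZero_eq_natCast (x : Γ) : ∃ n : ℕ,
    ∑ u : Γ, extendByZero H ρ.character u * extendByZero H ρ.character (x⁻¹ * u⁻¹ * x) = n := by
  classical
  obtain ⟨n, hn⟩ := (endBiRep ρ).exists_sum_character_eq_natCast (conjPairs H x)
  refine ⟨n, hn ▸ ?_⟩
  simpa using sum_extendByZero_eq_sum_character ρ x 1

theorem sum_extendByZero_eq_zero {x : Γ}
    (h0 : ∑ u : Γ, extendByZero H ρ.character u *
      extendByZero H ρ.character (x⁻¹ * u⁻¹ * x) = 0) (z : Γ) :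
    ∑ u : Γ, extendByZero H ρ.character u *
      extendByZero H ρ.character (x⁻¹ * u⁻¹ * z) = 0 := by
  classical
  by_cases hz : ∃ p : H × H, z = (p.1 : Γ)⁻¹ * x * p.2
  · obtain ⟨p, rfl⟩ := hz
    rw [sum_extendByZero_eq_sum_character]
    refine (endBiRep ρ).sum_character_mul_eq_zero _ ?_ p
    simpa using (sum_extendByZero_eq_sum_character ρ x 1).symm.trans (by simpa using h0)
  · rw [sum_extendByZero_mul]
    refine Finset.sum_eq_zero fun u _ => ?_
    rw [extendByZero_of_notMem, mul_zero]
    exact fun hmem => hz ⟨(u⁻¹, ⟨_, hmem⟩), by simp [mul_assoc]⟩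

/-- The character induced from an irreducible character has norm one if and only if the twisted
inner products attached to the elements outside of the subgroup all vanish. -/
theorem induced_norm_one_iff
    (hρ : ∑ h : H, ρ.character h * ρ.character h⁻¹ = Fintype.card H) :
    ∑ g : Γ, ((Fintype.card H : ℂ)⁻¹ * ∑ y : Γ, extendByZero H ρ.character (y⁻¹ * g * y)) *
        ((Fintype.card H : ℂ)⁻¹ * ∑ y : Γ, extendByZero H ρ.character (y⁻¹ * g⁻¹ * y)) =
        Nat.card Γ ↔
      ∀ x ∉ H, ∑ u : Γ, extendByZero H ρ.character u *
        extendByZero H ρ.character (x⁻¹ * u⁻¹ * x) = 0 := by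
  classical
  choose n hn using exists_sum_extendByZero_eq_natCast ρ
  have hH : (Fintype.card H : ℂ) ≠ 0 := Nat.cast_ne_zero.mpr Fintype.card_ne_zero
  have hΓ : (Fintype.card Γ : ℂ) ≠ 0 := Nat.cast_ne_zero.mpr Fintype.card_ne_zero
  have hmem : ∑ x with x ∈ H, n x = Fintype.card H ^ 2 := by
    have hx : ∀ x ∈ Finset.univ.filter (· ∈ H), n x = Fintype.card H := by
      intro x hx
      rw [← Nat.cast_inj (R := ℂ), ← hn, ← hρ, sum_extendByZero_of_mem ρ (by simpa using hx)]
    rw [Finset.sum_congr rfl hx, Finset.sum_const, ← Fintype.card_subtype, sq, smul_eq_mul]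
  simp only [sum_induced_mul_induced_inv, hn, Nat.cast_eq_zero, Nat.card_eq_fintype_card]
  rw [← Finset.sum_filter_add_sum_filter_not Finset.univ (· ∈ H), ← Nat.cast_sum, ← Nat.cast_sum,
    hmem]
  have hiff : ((Fintype.card H : ℂ)⁻¹) ^ 2 * (Fintype.card Γ *
      (((Fintype.card H ^ 2 : ℕ) : ℂ) + ((∑ x with x ∉ H, n x : ℕ) : ℂ))) = Fintype.card Γ ↔
      ∑ x with x ∉ H, n x = 0 := by
    rw [← Nat.cast_eq_zero (R := ℂ)]
    generalize ((∑ x with x ∉ H, n x : ℕ) : ℂ) = s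
    push_cast
    field_simp
    simp
  rw [hiff]
  simp

end ExtendByZero

/-- Let `Γ` be a finite group, `Γ' ⊆ Γ` a subgroup, and `χ` the
character of an irreducible complex representation of `Γ'`.  Let `χ̄ : Γ → ℂ` be the
extension of `χ` by zero outside `Γ'`, and let
`Ind χ (g) = (1/|Γ'|) * ∑_{y ∈ Γ} χ̄ (y⁻¹ g y)` be the induced class function.
Then `Ind χ` is the character of an irreducible representation of `Γ` if and only if
`χ̄ * δ_x * χ̄ = 0` for every `x ∈ Γ` with `x ∉ Γ'`, where `δ_x` is the delta
function at `x`. -/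
theorem stmt_17 (Γ : Type) [Group Γ] [Fintype Γ] [DecidableEq Γ]
    (Γ' : Subgroup Γ) [DecidablePred (· ∈ Γ')]
    (χ : ↥Γ' → ℂ) (hχ : ∃ V : FDRep ℂ ↥Γ', Simple V ∧ FDRep.character V = χ) :
    (∃ W : FDRep ℂ Γ, Simple W ∧ FDRep.character W =
        fun g : Γ => (Fintype.card ↥Γ' : ℂ)⁻¹ *
          ∑ y : Γ, (if h : y⁻¹ * g * y ∈ Γ' then χ ⟨y⁻¹ * g * y, h⟩ else 0)) ↔
    (∀ x : Γ, x ∉ Γ' →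
      convFun
        (convFun (fun g : Γ => if h : g ∈ Γ' then χ ⟨g, h⟩ else 0)
          (fun u : Γ => if u = x then (1 : ℂ) else 0))
        (fun g : Γ => if h : g ∈ Γ' then χ ⟨g, h⟩ else 0) = 0) := by
  classical
  obtain ⟨V, hV, rfl⟩ := hχ
  have hnorm : ∑ h : Γ', V.character h * V.character h⁻¹ = Fintype.card Γ' := by
    rw [← Nat.card_eq_fintype_card]
    exact (FDRep.simple_iff_char_is_norm_one V).mp hV
  have hconv (x : Γ) : convFun (convFun (extendByZero Γ' V.character)
      (fun u : Γ => if u = x then (1 : ℂ) else 0)) (extendByZero Γ' V.character) = 0 ↔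
      ∑ u : Γ, extendByZero Γ' V.character u *
        extendByZero Γ' V.character (x⁻¹ * u⁻¹ * x) = 0 := by
    constructor
    · intro h
      rw [← convFun_convFun_delta, h, Pi.zero_apply]
    · intro h
      ext z
      rw [convFun_convFun_delta]
      exact sum_extendByZero_eq_zero V.ρ h z
  have hmain := induced_norm_one_iff V.ρ hnorm
  refine Iff.trans ?_ (hmain.trans (forall₂_congr fun x _ => (hconv x).symm))
  constructor
  · rintro ⟨W, hW, hchar⟩
    have := (FDRep.simple_iff_char_is_norm_one W).mp hW
    rw [hchar] at this
    exact this
  · intro h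
    let W : FDRep ℂ Γ := FDRep.of (Representation.coind Γ'.subtype V.ρ)
    have hchar : W.character = fun g : Γ => (Fintype.card Γ' : ℂ)⁻¹ *
        ∑ y : Γ, extendByZero Γ' V.character (y⁻¹ * g * y) :=
      funext (Representation.character_coind_subtype Γ' V.ρ)
    refine ⟨W, (FDRep.simple_iff_char_is_norm_one W).mpr ?_, hchar⟩
    rw [hchar]
    exact h
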